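/- Let $f(\mathbf{x})=\sum_{j=1}^q p_j\mathcal{N}_{\mathbf{w}_j,K_j}(\mathbf{x})$ be a Gaussian mixture density on $\mathbb{R}^n$ and let $m\ge \sup_{\mathbf{x}\in\mathbb{R}^n}f(\mathbf{x})$. Then the differential entropy satisfies $h(\mathbf{X})=-\int_{\mathbb{R}^n}f(\mathbf{x})\ln f(\mathbf{x})\,\mathrm{d}\mathbf{x} = -\ln m+\sum_{k=1}^{\infty}\frac1k\int_{\mathbb{R}^n}f(\mathbf{x})\Big(1-\frac{f(\mathbf{x})}{m}\Big)^k\mathrm{d}\mathbf{x}$, i.e. the series on the right converges to $h(\mathbf{X})+\ln m$. -/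

import Mathlib

open Matrix MeasureTheory

/-- The Gaussian density on `ℝⁿ` with mean `w` and covariance matrix `K`. -/
noncomputable def gaussianDensity (n : ℕ) (K : Matrix (Fin n) (Fin n) ℝ)
    (w : Fin n → ℝ) (x : Fin n → ℝ) : ℝ :=
  (2 * Real.pi) ^ (-(n : ℝ) / 2) * K.det ^ (-(1 : ℝ) / 2) *
    Real.exp (-(1 / 2) * ((x - w) ⬝ᵥ (K⁻¹ *ᵥ (x - w))))

open scoped MatrixOrder in
/-- The inverse of a positive definite matrix is a Gram matrix `Bᵀ * B` with `B` invertible. -/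
lemma Matrix.PosDef.exists_inv_eq_transpose_mul_self {n : ℕ} {K : Matrix (Fin n) (Fin n) ℝ}
    (hK : K.PosDef) : ∃ B : Matrix (Fin n) (Fin n) ℝ, B.det ≠ 0 ∧ K⁻¹ = Bᵀ * B := by
  obtain ⟨B, hB⟩ := CStarAlgebra.nonneg_iff_eq_star_mul_self.mp hK.inv.posSemidef.nonneg
  rw [star_eq_conjTranspose, conjTranspose_eq_transpose_of_trivial] at hB
  refine ⟨B, fun h0 => ?_, hB⟩
  have h := hK.inv.det_pos
  rw [hB, det_mul, h0, mul_zero] at h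
  exact h.false

lemma dotProduct_transpose_mul_self_mulVec {n : ℕ} (B : Matrix (Fin n) (Fin n) ℝ)
    (v : Fin n → ℝ) : v ⬝ᵥ ((Bᵀ * B) *ᵥ v) = (B *ᵥ v) ⬝ᵥ (B *ᵥ v) := by
  rw [← mulVec_mulVec, dotProduct_mulVec, vecMul_transpose]

lemma exp_neg_mul_dotProduct_self {n : ℕ} (b : ℝ) (y : Fin n → ℝ) :
    Real.exp (-b * (y ⬝ᵥ y)) = ∏ i, Real.exp (-b * y i ^ 2) := by
  rw [← Real.exp_sum, dotProduct, Finset.mul_sum]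
  simp only [pow_two]

lemma integrable_exp_neg_mul_dotProduct_self {n : ℕ} {b : ℝ} (hb : 0 < b) :
    Integrable (fun y : Fin n → ℝ => Real.exp (-b * (y ⬝ᵥ y))) := by
  simp only [exp_neg_mul_dotProduct_self]
  exact Integrable.fintype_prod (fun _ : Fin n => integrable_exp_neg_mul_sq hb)

lemma integral_exp_neg_mul_dotProduct_self {n : ℕ} (b : ℝ) :
    ∫ y : Fin n → ℝ, Real.exp (-b * (y ⬝ᵥ y)) = √(Real.pi / b) ^ n := by
  simp only [exp_neg_mul_dotProduct_self]
  rw [integral_fintype_prod_volume_eq_pow (fun t : ℝ => Real.exp (-b * t ^ 2)),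
    integral_gaussian, Fintype.card_fin]

lemma measurable_toLin' {n : ℕ} (B : Matrix (Fin n) (Fin n) ℝ) : Measurable (toLin' B) :=
  (LinearMap.continuous_of_finiteDimensional (toLin' B)).measurable

lemma integrable_comp_mulVec_sub {n : ℕ} {B : Matrix (Fin n) (Fin n) ℝ} (hB : B.det ≠ 0)
    {g : (Fin n → ℝ) → ℝ} (hg : Integrable g) (w : Fin n → ℝ) :
    Integrable (fun x => g (B *ᵥ (x - w))) := by
  have h : Integrable g (Measure.map (toLin' B) volume) := by
    rw [Real.map_matrix_volume_pi_eq_smul_volume_pi hB]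
    exact hg.smul_measure ENNReal.ofReal_ne_top
  exact (h.comp_measurable (measurable_toLin' B)).comp_sub_right w

lemma integral_comp_mulVec_sub {n : ℕ} {B : Matrix (Fin n) (Fin n) ℝ} (hB : B.det ≠ 0)
    {g : (Fin n → ℝ) → ℝ} (hg : Integrable g) (w : Fin n → ℝ) :
    ∫ x, g (B *ᵥ (x - w)) = |B.det|⁻¹ * ∫ y, g y := by
  have h : AEStronglyMeasurable g (Measure.map (toLin' B) volume) := by
    rw [Real.map_matrix_volume_pi_eq_smul_volume_pi hB]
    exact (hg.smul_measure ENNReal.ofReal_ne_top).aestronglyMeasurable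
  have key := integral_map (measurable_toLin' B).aemeasurable h
  rw [Real.map_matrix_volume_pi_eq_smul_volume_pi hB, integral_smul_measure,
    ENNReal.toReal_ofReal (abs_nonneg _), abs_inv, smul_eq_mul] at key
  rw [integral_sub_right_eq_self (fun x => g (B *ᵥ x)) w, key]
  rfl

lemma gaussianDensity_pos {n : ℕ} {K : Matrix (Fin n) (Fin n) ℝ} (hK : K.PosDef)
    (w x : Fin n → ℝ) : 0 < gaussianDensity n K w x := by
  have := hK.det_pos
  unfold gaussianDensity
  positivity

lemma continuous_gaussianDensity {n : ℕ} (K : Matrix (Fin n) (Fin n) ℝ) (w : Fin n → ℝ) :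
    Continuous (gaussianDensity n K w) := by
  unfold gaussianDensity
  fun_prop

lemma gaussianDensity_le {n : ℕ} {K : Matrix (Fin n) (Fin n) ℝ} (hK : K.PosDef)
    (w x : Fin n → ℝ) :
    gaussianDensity n K w x ≤ (2 * Real.pi) ^ (-(n : ℝ) / 2) * K.det ^ (-(1 : ℝ) / 2) := by
  have := hK.det_pos
  have hQ : 0 ≤ (x - w) ⬝ᵥ (K⁻¹ *ᵥ (x - w)) := by
    simpa using hK.inv.posSemidef.dotProduct_mulVec_nonneg (x - w)
  exact mul_le_of_le_one_right (by positivity) (Real.exp_le_one_iff.2 (by linarith))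

lemma integrable_gaussianDensity {n : ℕ} {K : Matrix (Fin n) (Fin n) ℝ} (hK : K.PosDef)
    (w : Fin n → ℝ) : Integrable (gaussianDensity n K w) := by
  obtain ⟨B, hB, hKB⟩ := hK.exists_inv_eq_transpose_mul_self
  unfold gaussianDensity
  simp only [hKB, dotProduct_transpose_mul_self_mulVec]
  exact (integrable_comp_mulVec_sub hB
    (integrable_exp_neg_mul_dotProduct_self one_half_pos) w).const_mul _

lemma integrable_sqrt_gaussianDensity {n : ℕ} {K : Matrix (Fin n) (Fin n) ℝ} (hK : K.PosDef)
    (w : Fin n → ℝ) : Integrable (fun x => √(gaussianDensity n K w x)) := by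
  obtain ⟨B, hB, hKB⟩ := hK.exists_inv_eq_transpose_mul_self
  have hdet := hK.det_pos
  have h : (fun x => √(gaussianDensity n K w x)) = fun x =>
      √((2 * Real.pi) ^ (-(n : ℝ) / 2) * K.det ^ (-(1 : ℝ) / 2)) *
        Real.exp (-(1 / 4) * ((B *ᵥ (x - w)) ⬝ᵥ (B *ᵥ (x - w)))) := by
    funext x
    rw [gaussianDensity, hKB, dotProduct_transpose_mul_self_mulVec,
      Real.sqrt_mul (by positivity), Real.sqrt_eq_rpow (Real.exp _), ← Real.exp_mul]
    ring_nf
  rw [h]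
  exact (integrable_comp_mulVec_sub hB
    (integrable_exp_neg_mul_dotProduct_self (b := 1 / 4) (by norm_num)) w).const_mul _

lemma integral_gaussianDensity {n : ℕ} {K : Matrix (Fin n) (Fin n) ℝ} (hK : K.PosDef)
    (w : Fin n → ℝ) : ∫ x, gaussianDensity n K w x = 1 := by
  obtain ⟨B, hB, hKB⟩ := hK.exists_inv_eq_transpose_mul_self
  have hdetB : K.det ^ (-(1 : ℝ) / 2) = |B.det| := by
    have h : K.det⁻¹ = B.det ^ 2 := by
      rw [← Ring.inverse_eq_inv', ← det_nonsing_inv, hKB, det_mul, det_transpose, sq]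
    rw [neg_div, Real.rpow_neg hK.det_pos.le, ← Real.inv_rpow hK.det_pos.le, h,
      ← Real.sqrt_eq_rpow, Real.sqrt_sq_eq_abs]
  have hpi : (2 * Real.pi) ^ (-(n : ℝ) / 2) * √(Real.pi / (1 / 2)) ^ n = 1 := by
    have h2 : (0 : ℝ) < 2 * Real.pi := by positivity
    rw [show Real.pi / (1 / 2) = 2 * Real.pi by ring, Real.sqrt_eq_rpow, ← Real.rpow_natCast,
      ← Real.rpow_mul h2.le, ← Real.rpow_add h2]
    ring_nf
    exact Real.rpow_zero _
  unfold gaussianDensity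
  simp only [hKB, dotProduct_transpose_mul_self_mulVec]
  rw [integral_const_mul, integral_comp_mulVec_sub hB
    (integrable_exp_neg_mul_dotProduct_self one_half_pos) w,
    integral_exp_neg_mul_dotProduct_self, hdetB]
  have hB' : |B.det| ≠ 0 := abs_ne_zero.2 hB
  calc _ = ((2 * Real.pi) ^ (-(n : ℝ) / 2) * √(Real.pi / (1 / 2)) ^ n)
        * (|B.det| * |B.det|⁻¹) := by ring
    _ = 1 := by rw [hpi, mul_inv_cancel₀ hB', one_mul]

lemma neg_mul_log_le_two_mul_sqrt {t : ℝ} (ht : 0 < t) : t * -Real.log t ≤ 2 * √t := by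
  have hs : 0 < √t := Real.sqrt_pos.2 ht
  have h1 : -Real.log √t ≤ (√t)⁻¹ := by
    have := Real.log_le_sub_one_of_pos (inv_pos.2 hs)
    rw [Real.log_inv] at this
    linarith
  rw [Real.log_sqrt ht.le] at h1
  calc t * -Real.log t ≤ t * (2 * (√t)⁻¹) :=
        mul_le_mul_of_nonneg_left (by linarith) ht.le
    _ = 2 * (√t * √t * (√t)⁻¹) := by rw [Real.mul_self_sqrt ht.le]; ring
    _ = 2 * √t := by rw [mul_inv_cancel_right₀ hs.ne']

/-- The Taylor series of the entropy of a positive bounded density whose square root is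
integrable. -/
lemma hasSum_integral_mul_one_sub_pow {α : Type*} [MeasurableSpace α] {μ : Measure α}
    {f : α → ℝ} {m : ℝ} (hf : Integrable f μ) (hsqrt : Integrable (fun x => √(f x)) μ)
    (hpos : ∀ x, 0 < f x) (hle : ∀ x, f x ≤ m) (hm : 0 < m) :
    HasSum (fun k : ℕ => (1 / ((k : ℝ) + 1)) * ∫ x, f x * (1 - f x / m) ^ (k + 1) ∂μ)
      ((-∫ x, f x * Real.log (f x) ∂μ) + Real.log m * ∫ x, f x ∂μ) := by
  have hsm := hf.aestronglyMeasurable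
  have hZ0 : ∀ x, 0 ≤ 1 - f x / m := fun x => sub_nonneg.2 ((div_le_one hm).2 (hle x))
  have hZ1 : ∀ x, 1 - f x / m < 1 := fun x => sub_lt_self _ (div_pos (hpos x) hm)
  have hlogm : AEStronglyMeasurable (fun x => f x * -Real.log (f x / m)) μ :=
    hsm.mul (Real.measurable_log.comp_aemeasurable
      (hsm.aemeasurable.div_const m)).aestronglyMeasurable.neg
  have hsum : ∀ x, HasSum (fun k : ℕ => (1 / ((k : ℝ) + 1)) * (f x * (1 - f x / m) ^ (k + 1)))
      (f x * -Real.log (f x / m)) := fun x => by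
    have h := (Real.hasSum_pow_div_log_of_abs_lt_one
      (abs_lt.2 ⟨by linarith [hZ0 x], hZ1 x⟩)).mul_left (f x)
    rw [sub_sub_cancel] at h
    convert! h using 2
    ring
  have hint : Integrable (fun x => f x * -Real.log (f x / m)) μ := by
    refine (hsqrt.const_mul (m * (2 * (√m)⁻¹))).mono' hlogm (ae_of_all _ fun x => ?_)
    have ht : 0 < f x / m := div_pos (hpos x) hm
    have h := neg_mul_log_le_two_mul_sqrt ht
    have hlog := Real.log_nonpos ht.le ((div_le_one hm).2 (hle x))
    rw [Real.norm_of_nonneg (mul_nonneg (hpos x).le (neg_nonneg.2 hlog))]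
    rw [Real.sqrt_div (hpos x).le] at h
    calc f x * -Real.log (f x / m) = m * (f x / m * -Real.log (f x / m)) := by field_simp
      _ ≤ m * (2 * (√(f x) / √m)) := mul_le_mul_of_nonneg_left h hm.le
      _ = m * (2 * (√m)⁻¹) * √(f x) := by ring
  have key := hasSum_integral_of_dominated_convergence (μ := μ)
    (F := fun (k : ℕ) x => (1 / ((k : ℝ) + 1)) * (f x * (1 - f x / m) ^ (k + 1)))
    (f := fun x => f x * -Real.log (f x / m))
    (fun (k : ℕ) x => (1 / ((k : ℝ) + 1)) * (f x * (1 - f x / m) ^ (k + 1)))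
    (fun k => (hsm.mul (((hsm.aemeasurable.div_const m).const_sub 1).pow_const
      (k + 1)).aestronglyMeasurable).const_mul _)
    (fun k => ae_of_all _ fun x => (Real.norm_of_nonneg (by
      have := hZ0 x
      have := hpos x
      positivity)).le)
    (ae_of_all _ fun x => (hsum x).summable)
    (by simpa only [(hsum _).tsum_eq] using hint)
    (ae_of_all _ hsum)
  simp only [integral_const_mul] at key
  convert! key using 1
  have hflog : ∀ x, f x * Real.log (f x) = Real.log m * f x - f x * -Real.log (f x / m) :=
    fun x => by
      rw [Real.log_div (hpos x).ne' hm.ne']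
      ring
  simp only [hflog]
  rw [integral_sub (hf.const_mul _) hint, integral_const_mul]
  ring

lemma sqrt_sum_le_sum_sqrt {ι : Type*} (s : Finset ι) {a : ι → ℝ} (ha : ∀ i, 0 ≤ a i) :
    √(∑ i ∈ s, a i) ≤ ∑ i ∈ s, √(a i) := by
  refine Real.sqrt_le_iff.2 ⟨Finset.sum_nonneg fun i _ => Real.sqrt_nonneg _, ?_⟩
  calc ∑ i ∈ s, a i = ∑ i ∈ s, √(a i) ^ 2 := by simp only [Real.sq_sqrt (ha _)]
    _ ≤ (∑ i ∈ s, √(a i)) ^ 2 := Finset.sum_sq_le_sq_sum_of_nonneg fun i _ => Real.sqrt_nonneg _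

theorem taylor_entropy_series
    (n q : ℕ) (hn : 0 < n) (hq : 0 < q)
    (p : Fin q → ℝ) (hp : ∀ j, 0 < p j) (hp1 : ∑ j, p j = 1)
    (Kc : Fin q → Matrix (Fin n) (Fin n) ℝ) (hK : ∀ i, (Kc i).PosDef)
    (w : Fin q → (Fin n → ℝ))
    (f : (Fin n → ℝ) → ℝ)
    (hf : ∀ x, f x = ∑ j, p j * gaussianDensity n (Kc j) (w j) x)
    (m : ℝ) (hm : (⨆ x : Fin n → ℝ, f x) ≤ m) :
    HasSum
      (fun k : ℕ => (1 / ((k : ℝ) + 1)) *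
        ∫ x : Fin n → ℝ, f x * (1 - f x / m) ^ (k + 1))
      ((-∫ x : Fin n → ℝ, f x * Real.log (f x)) + Real.log m) := by
  have hne : (Finset.univ : Finset (Fin q)).Nonempty := ⟨⟨0, hq⟩, Finset.mem_univ _⟩
  have hterm : ∀ j x, 0 < p j * gaussianDensity n (Kc j) (w j) x :=
    fun j x => mul_pos (hp j) (gaussianDensity_pos (hK j) _ _)
  have hpos : ∀ x, 0 < f x := fun x => by
    rw [hf]
    exact Finset.sum_pos (fun j _ => hterm j x) hne
  have hbdd : BddAbove (Set.range f) := by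
    refine ⟨∑ j, p j * ((2 * Real.pi) ^ (-(n : ℝ) / 2) * (Kc j).det ^ (-(1 : ℝ) / 2)), ?_⟩
    rintro _ ⟨x, rfl⟩
    rw [hf]
    exact Finset.sum_le_sum fun j _ =>
      mul_le_mul_of_nonneg_left (gaussianDensity_le (hK j) _ _) (hp j).le
  have hle : ∀ x, f x ≤ m := fun x => (le_ciSup hbdd x).trans hm
  have hint : ∀ j, Integrable (fun x => p j * gaussianDensity n (Kc j) (w j) x) :=
    fun j => (integrable_gaussianDensity (hK j) (w j)).const_mul (p j)
  obtain rfl : f = fun x => ∑ j, p j * gaussianDensity n (Kc j) (w j) x := funext hf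
  have hsqrt : Integrable
      (fun x => √(∑ j, p j * gaussianDensity n (Kc j) (w j) x)) := by
    have hdom : Integrable (fun x => ∑ j, √(p j) * √(gaussianDensity n (Kc j) (w j) x)) :=
      integrable_finsetSum _ fun j _ =>
        (integrable_sqrt_gaussianDensity (hK j) (w j)).const_mul _
    have hcont : Continuous (fun x => √(∑ j, p j * gaussianDensity n (Kc j) (w j) x)) :=
      (continuous_finsetSum _ fun j _ =>
        (continuous_gaussianDensity (Kc j) (w j)).const_mul (p j)).sqrt
    refine hdom.mono' hcont.aestronglyMeasurable (ae_of_all _ fun x => ?_)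
    rw [Real.norm_of_nonneg (Real.sqrt_nonneg _)]
    refine (sqrt_sum_le_sum_sqrt _ fun j => (hterm j x).le).trans_eq ?_
    simp only [Real.sqrt_mul (hp _).le]
  have h := hasSum_integral_mul_one_sub_pow (integrable_finsetSum _ fun j _ => hint j) hsqrt
    hpos hle ((hpos 0).trans_le (hle 0))
  rwa [integral_finsetSum _ fun j _ => hint j,
    show ∑ j, ∫ x, p j * gaussianDensity n (Kc j) (w j) x = 1 by
      simp only [integral_const_mul, integral_gaussianDensity (hK _), mul_one, hp1],
    mul_one] at h
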